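/- Let Ψ be an expansion system that is proper at every order w.r.t. every element of S_0, endow ∏_{i∈ℕ} C_i with the product topology 𝒟* in which each C_i is discrete, and suppose the topology on S_0 is coarser than or equal to the topology induced by P̂ from the discrete topology on ∏ C_i. If P̂ : S_0 → (∏ C_i, 𝒟*) is a closed map, then Ψ is accurate, i.e. for every y ∈ S_0 the convergents y^{[n]} converge to y in S_0. -/

import Mathlib

/-- An *expansion system* `Ψ`: element spaces `S i` with neutral elements `ν i`,
coefficient spaces `C i`, projections `P i : S i → C i` and expansions
`E i : S i → S (i+1)` such that `E i (ν i) = ν (i+1)` and each combined map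
`F i = (P i, E i) : S i → C i × S (i+1)` is injective. -/
structure ExpansionSystem where
  S : ℕ → Type*
  C : ℕ → Type*
  ν : ∀ i, S i
  P : ∀ i, S i → C i
  E : ∀ i, S i → S (i + 1)
  E_ν : ∀ i, E i (ν i) = ν (i + 1)
  F_inj : ∀ i, Function.Injective (fun y : S i => (P i y, E i y))

namespace ExpansionSystem

variable (Ψ : ExpansionSystem)

/-- `iter Ψ i y` is the element `y_i`: `y_0 = y`, `y_{i+1} = E i y_i`. -/
def iter : ∀ i : ℕ, Ψ.S 0 → Ψ.S i
  | 0, y => y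
  | (i + 1), y => Ψ.E i (iter i y)

/-- The `i`-th coefficient `P̂_i y = P i (y_i)`. -/
def coeff (i : ℕ) (y : Ψ.S 0) : Ψ.C i := Ψ.P i (Ψ.iter i y)

/-- The coefficient map `P̂ : S 0 → ∏ i, C i`. -/
def coeffMap (y : Ψ.S 0) : ∀ i, Ψ.C i := fun i => Ψ.coeff i y

/-- `a` records the backward recursion defining the `n`-th convergent of `y`:
`a n = ν n` and, for `i < n`, `F i (a i) = (P̂_i y, a (i+1))`, i.e.
`a i = F i ⁻¹ (P̂_i y, a (i+1))`; in particular at each step the pair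
`(P̂_i y, a (i+1))` lies in the image of `F i`. -/
def IsChain (n : ℕ) (y : Ψ.S 0) (a : ∀ i, Ψ.S i) : Prop :=
  a n = Ψ.ν n ∧ ∀ i < n, Ψ.P i (a i) = Ψ.coeff i y ∧ Ψ.E i (a i) = a (i + 1)

/-- `Ψ` is *proper at order `n` w.r.t. `y`*: the backward recursion
`y_n^[n] = ν n`, `y_i^[n] = F i ⁻¹ (P̂_i y, y_{i+1}^[n])` is well defined. -/
def ProperAt (n : ℕ) (y : Ψ.S 0) : Prop := ∃ a, Ψ.IsChain n y a

/-- `z` is the `n`-th convergent `y^[n]` of `y` (the outcome `y_0^[n]` of the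
backward recursion). -/
def IsConvergent (n : ℕ) (y z : Ψ.S 0) : Prop := ∃ a, Ψ.IsChain n y a ∧ a 0 = z

end ExpansionSystem

/-- The product topology `𝒟*` on `∏ i, C i` in which each `C i` is discrete. -/
def ExpansionSystem.discreteProd (Ψ : ExpansionSystem) : TopologicalSpace (∀ i, Ψ.C i) :=
  @Pi.topologicalSpace ℕ (fun i => Ψ.C i) (fun _ => ⊥)

namespace ExpansionSystem

theorem IsChain.iter_eq {Ψ : ExpansionSystem} {n : ℕ} {y : Ψ.S 0} {a : ∀ i, Ψ.S i}
    (h : Ψ.IsChain n y a) : ∀ i ≤ n, Ψ.iter i (a 0) = a i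
  | 0, _ => rfl
  | i + 1, hi => by
    rw [iter, h.iter_eq i (Nat.le_of_succ_le hi), (h.2 i hi).2]

theorem IsConvergent.coeff_eq {Ψ : ExpansionSystem} {n : ℕ} {y z : Ψ.S 0}
    (h : Ψ.IsConvergent n y z) {i : ℕ} (hi : i < n) : Ψ.coeff i z = Ψ.coeff i y := by
  obtain ⟨a, ha, rfl⟩ := h
  rw [coeff, ha.iter_eq i hi.le, (ha.2 i hi).1]

theorem tendsto_coeffMap_of_isConvergent {Ψ : ExpansionSystem} {y : Ψ.S 0} {c : ℕ → Ψ.S 0}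
    (hc : ∀ n, Ψ.IsConvergent n y (c n)) :
    Filter.Tendsto (fun n => Ψ.coeffMap (c n)) Filter.atTop
      (@nhds _ Ψ.discreteProd (Ψ.coeffMap y)) := by
  let (i : ℕ) : TopologicalSpace (Ψ.C i) := ⊥
  refine tendsto_pi_nhds.2 fun i => tendsto_const_nhds.congr' ?_
  filter_upwards [Filter.eventually_gt_atTop i] with n hn
  exact ((hc n).coeff_eq hn).symm

end ExpansionSystem

/-- let `Ψ` be proper at every order w.r.t. every element, endow
`∏ i, C i` with the product topology `𝒟*` of discrete topologies, and let the
topology `tS` on `S 0` be coarser than or equal to the topology induced by `P̂`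
from the discrete topology on `∏ i, C i`. If `P̂ : (S 0, tS) → (∏ i, C i, 𝒟*)` is a
closed map, then `Ψ` is accurate: for every `y`, the convergents `y^[n]` converge
to `y` in `tS`. -/
theorem stmt10 (Ψ : ExpansionSystem) (tS : TopologicalSpace (Ψ.S 0))
    (hproper : ∀ (z : Ψ.S 0) (n : ℕ), Ψ.ProperAt n z)
    (hcoarse : TopologicalSpace.induced Ψ.coeffMap (⊥ : TopologicalSpace (∀ i, Ψ.C i)) ≤ tS)
    (hclosedmap : @IsClosedMap _ _ tS Ψ.discreteProd Ψ.coeffMap) :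
    ∀ (y : Ψ.S 0) (c : ℕ → Ψ.S 0), (∀ n, Ψ.IsConvergent n y (c n)) →
      Filter.Tendsto c Filter.atTop (@nhds _ tS y) := by
  intro y c hc
  let _ := Ψ.discreteProd
  refine tendsto_nhds.2 fun U hU hy => ?_
  have hV : IsOpen (Ψ.coeffMap '' Uᶜ)ᶜ := (hclosedmap _ hU.isClosed_compl).isOpen_compl
  have hyV : Ψ.coeffMap y ∈ (Ψ.coeffMap '' Uᶜ)ᶜ := by
    rintro ⟨z, hz, hzy⟩
    obtain ⟨W, -, rfl⟩ := hcoarse U hU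
    exact hz (show Ψ.coeffMap z ∈ W from hzy ▸ hy)
  filter_upwards [(ExpansionSystem.tendsto_coeffMap_of_isConvergent hc).eventually_mem
    (hV.mem_nhds hyV)] with n hn
  by_contra hnU
  exact hn ⟨c n, hnU, rfl⟩
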